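/- arXiv:1001.1480 — 6 statements merged into one kernel-verified Lean document; each statement's English description precedes it below -/
import Mathlib

section
/- Let α = u_α/v_α, β = u_β/v_β, γ = u_γ/v_γ, δ = u_δ/v_δ be positive rationals in lowest terms, and let 𝕄 := { [[α·n₁, l₁/γ],[β·n₂, l₂/δ]] : n₁, n₂, l₁, l₂ ∈ ℤ } be the corresponding set of 2×2 rational matrices. Set μ := lcm( u_α·u_γ / gcd(u_α·u_γ, v_α·v_γ), u_β·u_δ / gcd(u_β·u_δ, v_β·v_δ) ) and ν := lcm( v_α·v_γ / gcd(u_α·u_γ, v_α·v_γ), v_β·v_δ / gcd(u_β·u_δ, v_β·v_δ) ). Then for every V = [[a,b],[c,d]] ∈ SL(2,ℤ) with μ ∣ c and ν ∣ b, right multiplication preserves 𝕄, i.e. 𝕄 · V = 𝕄 (every M·V with M ∈ 𝕄 lies in 𝕄 and every element of 𝕄 is of this form). -/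
/-- An integer divisible by the reduced numerator of `p / q` is an integer multiple of `p / q`. -/
theorem exists_int_mul_div_of_div_gcd_dvd {p q : ℕ} (hp : 0 < p) (hq : 0 < q) {c : ℤ}
    (h : ((p / Nat.gcd p q : ℕ) : ℤ) ∣ c) : ∃ k : ℤ, (c : ℚ) = k * ((p : ℚ) / q) := by
  obtain ⟨k, rfl⟩ := h
  obtain ⟨r, hr⟩ := Nat.gcd_dvd_left p q
  obtain ⟨s, hs⟩ := Nat.gcd_dvd_right p q
  have hg : 0 < Nat.gcd p q := Nat.gcd_pos_of_pos_left q hp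
  have hpr : p / Nat.gcd p q = r := Nat.div_eq_of_eq_mul_right hg hr
  have hr' : (p : ℚ) = Nat.gcd p q * r := by exact_mod_cast hr
  have hs' : (q : ℚ) = Nat.gcd p q * s := by exact_mod_cast hs
  have hq' : (q : ℚ) ≠ 0 := by positivity
  refine ⟨k * s, ?_⟩
  rw [hpr]
  push_cast
  rw [mul_div_assoc', eq_div_iff hq', hr', hs']
  ring

/-- Rows of the form `(α n, l / γ)` are mapped to rows of the same form by a matrix whose
off-diagonal entries satisfy the appropriate integrality conditions. -/
theorem exists_row_mul {α γ : ℚ} (hγ : γ ≠ 0) {a b c d k m : ℤ}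
    (hc : (c : ℚ) = k * (α * γ)) (hb : (b : ℚ) * (α * γ) = m) (n l : ℤ) :
    ∃ n' l' : ℤ, α * n * a + l / γ * c = α * (n' : ℚ) ∧
      α * n * b + l / γ * d = (l' : ℚ) / γ := by
  refine ⟨n * a + l * k, n * m + l * d, ?_, ?_⟩
  · rw [hc]
    push_cast
    field_simp
  · push_cast
    rw [← hb]
    field_simp

/-- Divisibility of the off-diagonal entries by the reduced numerator and denominator of
`(u / v) * (u' / v')` yields the integrality conditions used in `exists_row_mul`. -/
theorem exists_integrality_witnesses {u v u' v' : ℕ} (hu : 0 < u) (hv : 0 < v) (hu' : 0 < u')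
    (hv' : 0 < v') {b c : ℤ}
    (hb : (((v * v') / Nat.gcd (u * u') (v * v') : ℕ) : ℤ) ∣ b)
    (hc : (((u * u') / Nat.gcd (u * u') (v * v') : ℕ) : ℤ) ∣ c) :
    ∃ k m : ℤ, (c : ℚ) = k * ((u : ℚ) / v * ((u' : ℚ) / v')) ∧
      (b : ℚ) * ((u : ℚ) / v * ((u' : ℚ) / v')) = m := by
  rw [Nat.gcd_comm] at hb
  obtain ⟨k, hk⟩ := exists_int_mul_div_of_div_gcd_dvd (Nat.mul_pos hu hu') (Nat.mul_pos hv hv') hc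
  obtain ⟨m, hm⟩ := exists_int_mul_div_of_div_gcd_dvd (Nat.mul_pos hv hv') (Nat.mul_pos hu hu') hb
  refine ⟨k, m, ?_, ?_⟩
  · rw [hk]
    push_cast
    rw [div_mul_div_comm]
  · rw [hm]
    push_cast
    field_simp

/-- let `α = u_α/v_α`, `β = u_β/v_β`, `γ = u_γ/v_γ`, `δ = u_δ/v_δ` be
positive rationals in lowest terms and
`𝕄 = { [[α·n₁, l₁/γ],[β·n₂, l₂/δ]] : n₁,n₂,l₁,l₂ ∈ ℤ }`. With
`μ = lcm(u_α u_γ/gcd(u_α u_γ, v_α v_γ), u_β u_δ/gcd(u_β u_δ, v_β v_δ))` and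
`ν = lcm(v_α v_γ/gcd(u_α u_γ, v_α v_γ), v_β v_δ/gcd(u_β u_δ, v_β v_δ))`,
right multiplication by any `V = [[a,b],[c,d]] ∈ SL(2,ℤ)` with `μ ∣ c`, `ν ∣ b`
preserves `𝕄`: `𝕄 · V = 𝕄`. -/
theorem stmt_10 (ua va ub vb ug vg ud vd : ℕ)
    (hua : 0 < ua) (hva : 0 < va) (hub : 0 < ub) (hvb : 0 < vb)
    (hug : 0 < ug) (hvg : 0 < vg) (hud : 0 < ud) (hvd : 0 < vd)
    (ha : Nat.gcd ua va = 1) (hb : Nat.gcd ub vb = 1)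
    (hg : Nat.gcd ug vg = 1) (hd : Nat.gcd ud vd = 1)
    (α β γ δ : ℚ) (hα : α = (ua : ℚ) / va) (hβ : β = (ub : ℚ) / vb)
    (hγ : γ = (ug : ℚ) / vg) (hδ : δ = (ud : ℚ) / vd)
    (M : Set (Matrix (Fin 2) (Fin 2) ℚ))
    (hM : M = {A | ∃ n₁ n₂ l₁ l₂ : ℤ,
        A = !![α * (n₁ : ℚ), (l₁ : ℚ) / γ; β * (n₂ : ℚ), (l₂ : ℚ) / δ]})
    (μ ν : ℕ)
    (hμ : μ = Nat.lcm ((ua * ug) / Nat.gcd (ua * ug) (va * vg))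
        ((ub * ud) / Nat.gcd (ub * ud) (vb * vd)))
    (hν : ν = Nat.lcm ((va * vg) / Nat.gcd (ua * ug) (va * vg))
        ((vb * vd) / Nat.gcd (ub * ud) (vb * vd)))
    (V : Matrix.SpecialLinearGroup (Fin 2) ℤ)
    (hVb : (ν : ℤ) ∣ V.1 0 1) (hVc : (μ : ℤ) ∣ V.1 1 0) :
    (fun A => A * (V.1.map fun z : ℤ => (z : ℚ))) '' M = M := by
  have hγ0 : γ ≠ 0 := by rw [hγ]; positivity
  have hδ0 : δ ≠ 0 := by rw [hδ]; positivity
  have maps : ∀ W : Matrix.SpecialLinearGroup (Fin 2) ℤ, (ν : ℤ) ∣ W.1 0 1 → (μ : ℤ) ∣ W.1 1 0 →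
      ∀ A ∈ M, A * (W.1.map fun z : ℤ => (z : ℚ)) ∈ M := by
    intro W hb' hc' A hA
    rw [hM] at hA ⊢
    obtain ⟨n₁, n₂, l₁, l₂, rfl⟩ := hA
    rw [hν] at hb'
    rw [hμ] at hc'
    obtain ⟨k₁, m₁, hk₁, hm₁⟩ := exists_integrality_witnesses hua hva hug hvg
      ((Int.natCast_dvd_natCast.mpr (Nat.dvd_lcm_left _ _)).trans hb')
      ((Int.natCast_dvd_natCast.mpr (Nat.dvd_lcm_left _ _)).trans hc')
    obtain ⟨k₂, m₂, hk₂, hm₂⟩ := exists_integrality_witnesses hub hvb hud hvd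
      ((Int.natCast_dvd_natCast.mpr (Nat.dvd_lcm_right _ _)).trans hb')
      ((Int.natCast_dvd_natCast.mpr (Nat.dvd_lcm_right _ _)).trans hc')
    rw [← hα, ← hγ] at hk₁ hm₁
    rw [← hβ, ← hδ] at hk₂ hm₂
    obtain ⟨n₁', l₁', h₁, h₁'⟩ :=
      exists_row_mul (a := W.1 0 0) (d := W.1 1 1) hγ0 hk₁ hm₁ n₁ l₁
    obtain ⟨n₂', l₂', h₂, h₂'⟩ :=
      exists_row_mul (a := W.1 0 0) (d := W.1 1 1) hδ0 hk₂ hm₂ n₂ l₂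
    refine ⟨n₁', n₂', l₁', l₂', ?_⟩
    rw [← h₁, ← h₁', ← h₂, ← h₂']
    ext i j
    fin_cases i <;> fin_cases j <;> simp [Matrix.mul_apply, Fin.sum_univ_two]
  apply Set.Subset.antisymm
  · rintro _ ⟨A, hA, rfl⟩
    exact maps V hVb hVc A hA
  · intro A hA
    refine ⟨A * ((V⁻¹).1.map fun z : ℤ => (z : ℚ)), maps V⁻¹ ?_ ?_ A hA, ?_⟩
    · simpa [Matrix.SpecialLinearGroup.coe_inv, Matrix.adjugate_fin_two] using hVb
    · simpa [Matrix.SpecialLinearGroup.coe_inv, Matrix.adjugate_fin_two] using hVc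
    · have hinv : (V⁻¹).1 * V.1 = 1 := congrArg Subtype.val (inv_mul_cancel V)
      have hmap := congrArg (fun X => X.map (Int.castRingHom ℚ)) hinv
      simp only [Matrix.map_mul] at hmap
      have hone : (1 : Matrix (Fin 2) (Fin 2) ℤ).map (Int.castRingHom ℚ) = 1 := by simp
      rw [hone] at hmap
      change A * ((V⁻¹).1.map (Int.castRingHom ℚ)) * (V.1.map (Int.castRingHom ℚ)) = A
      rw [Matrix.mul_assoc, hmap, Matrix.mul_one]
end

section
/- Let δ be a positive integer and let A = [[n₁, l₁],[n₂, l₂/δ]] be a 2×2 rational matrix with n₁, n₂, l₁, l₂ ∈ ℤ such that det A ≠ 0 and no prime divisor of δ divides l₂ (i.e. gcd(l₂, δ) = 1). Then there exist unique integers k, j, p and a unique matrix P ∈ Γ₀(δ) such that k > j ≥ 0, p ≠ 0, and A = [[k, j],[0, p/δ]] · P. -/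
/-- Over `ℤ`, every pair of rows `(n, l)`, `(m, q)` with nonzero determinant factors as an upper
triangular matrix with reduced upper row and positive corner times a matrix of determinant one. -/
lemma exists_upper_triangular_mul_of_det_ne_zero (n l m q : ℤ) (h : n * q - m * l ≠ 0) :
    ∃ k j p a b c d : ℤ, 0 ≤ j ∧ j < k ∧ p ≠ 0 ∧ a * d - b * c = 1 ∧
      k * a + j * c = n ∧ k * b + j * d = l ∧ p * c = m ∧ p * d = q := by
  have hg : 0 < Int.gcd m q := by
    rw [Int.gcd_pos_iff]
    by_contra! h'
    simp [h'.1, h'.2] at h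
  obtain ⟨c, d, hcop, hc, hd⟩ := Int.exists_gcd_one hg
  obtain ⟨p, c, d, hcd, hpc, hpd, hk⟩ : ∃ p c d : ℤ, IsCoprime c d ∧ p * c = m ∧ p * d = q ∧
      0 < n * d - c * l := by
    have hcop := Int.isCoprime_iff_gcd_eq_one.mpr hcop
    have hne : n * d - c * l ≠ 0 := by
      intro h0
      apply h
      linear_combination ((Int.gcd m q : ℕ) : ℤ) * h0 + n * hd - l * hc
    rcases lt_or_gt_of_ne hne with h0 | h0
    · exact ⟨-(Int.gcd m q : ℕ), -c, -d, hcop.neg_neg, by linarith, by linarith, by linarith⟩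
    · exact ⟨(Int.gcd m q : ℕ), c, d, hcop, by linarith, by linarith, h0⟩
  obtain ⟨u, v, huv⟩ := hcd
  set k := n * d - c * l with hkdef
  set t := (v * l + u * n) / k with ht
  have hdm := Int.emod_add_mul_ediv (v * l + u * n) k
  rw [← ht] at hdm
  refine ⟨k, (v * l + u * n) % k, p, v + t * c, -u + t * d, c, d, Int.emod_nonneg _ hk.ne',
    Int.emod_lt_of_pos _ hk, ?_, by linear_combination huv, ?_, ?_, hpc, hpd⟩
  · rintro rfl
    apply h
    rw [← hpc, ← hpd]
    ring
  · linear_combination c * hdm + n * huv + v * hkdef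
  · linear_combination d * hdm + l * huv - u * hkdef

/-- The factorization of `exists_upper_triangular_mul_of_det_ne_zero` is unique. -/
lemma upper_triangular_mul_unique {k j p a b c d k' j' p' a' b' c' d' : ℤ}
    (hj : 0 ≤ j) (hjk : j < k) (hp : p ≠ 0) (hP : a * d - b * c = 1)
    (hj' : 0 ≤ j') (hjk' : j' < k') (hP' : a' * d' - b' * c' = 1)
    (h₁ : k * a + j * c = k' * a' + j' * c') (h₂ : k * b + j * d = k' * b' + j' * d')
    (h₃ : p * c = p' * c') (h₄ : p * d = p' * d') :
    k = k' ∧ j = j' ∧ p = p' ∧ a = a' ∧ b = b' ∧ c = c' ∧ d = d' := by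
  have hkp : k * p = k' * p' := by
    linear_combination -(k * p) * hP + (k' * p') * hP' + p * d * h₁ - p * c * h₂
      + (k' * a' + j' * c') * h₄ - (k' * b' + j' * d') * h₃
  have hpp : p = p' := by
    have hd : p ∣ p' := ⟨a' * d - b' * c, by linear_combination -p' * hP' - a' * h₄ + b' * h₃⟩
    have hd' : p' ∣ p := ⟨a * d' - b * c', by linear_combination -p * hP + a * h₄ - b * h₃⟩
    rcases Int.natAbs_eq_natAbs_iff.mp (Int.natAbs_eq_of_dvd_dvd hd hd') with h | h
    · exact h
    · exfalso
      have : (k + k') * p = 0 := by linear_combination hkp + k' * h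
      rcases mul_eq_zero.mp this with h0 | h0
      · omega
      · exact hp h0
  subst hpp
  obtain rfl := mul_right_cancel₀ hp hkp
  obtain rfl := mul_left_cancel₀ hp h₃
  obtain rfl := mul_left_cancel₀ hp h₄
  have hdvd : k ∣ j - j' :=
    ⟨a * b' - b * a', by linear_combination -(j - j') * hP + a * h₂ - b * h₁⟩
  have hjj : j = j' := by
    have := Int.eq_zero_of_abs_lt_dvd hdvd (abs_lt.mpr ⟨by omega, by omega⟩)
    omega
  subst hjj
  have hk : k ≠ 0 := by omega
  exact ⟨rfl, rfl, rfl, mul_left_cancel₀ hk (by linarith), mul_left_cancel₀ hk (by linarith),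
    rfl, rfl⟩

/-- Entrywise form, with denominators cleared, of the factorization with corner `p / δ`. -/
lemma eq_upper_triangular_mul_iff {δ : ℕ} (hδ : 0 < δ) (n₁ n₂ l₁ l₂ k j p : ℤ)
    (M : Matrix (Fin 2) (Fin 2) ℤ) :
    !![(n₁ : ℚ), (l₁ : ℚ); (n₂ : ℚ), (l₂ : ℚ) / (δ : ℚ)] =
        !![(k : ℚ), (j : ℚ); 0, (p : ℚ) / (δ : ℚ)] * (M.map fun z : ℤ => (z : ℚ)) ↔
      k * M 0 0 + j * M 1 0 = n₁ ∧ k * M 0 1 + j * M 1 1 = l₁ ∧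
        p * M 1 0 = δ * n₂ ∧ p * M 1 1 = l₂ := by
  have hδ' : (δ : ℚ) ≠ 0 := by exact_mod_cast hδ.ne'
  rw [← Matrix.ext_iff]
  simp only [Fin.forall_fin_two, Matrix.mul_apply, Fin.sum_univ_two, Matrix.map_apply,
    Matrix.of_apply, Matrix.cons_val_zero, Matrix.cons_val_one, zero_mul, zero_add, and_assoc]
  qify
  have e₁ : (n₂ : ℚ) = p / δ * M 1 0 ↔ (p : ℚ) * M 1 0 = δ * n₂ := by
    field_simp
    exact eq_comm
  have e₂ : (l₂ : ℚ) / δ = p / δ * M 1 1 ↔ (p : ℚ) * M 1 1 = l₂ := by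
    field_simp
    exact eq_comm
  rw [e₁, e₂, eq_comm (a := (n₁ : ℚ)), eq_comm (a := (l₁ : ℚ))]

/-- let `δ > 0` and `A = [[n₁,l₁],[n₂,l₂/δ]]` be a rational matrix
with integer `n₁,n₂,l₁,l₂`, `det A ≠ 0` and `gcd(l₂,δ) = 1`. Then there are unique
integers `k > j ≥ 0`, `p ≠ 0` and a unique `P ∈ Γ₀(δ) ⊆ SL(2,ℤ)` (i.e. `δ ∣ c`-entry)
with `A = [[k,j],[0,p/δ]] · P`. -/
theorem stmt_12 (δ : ℕ) (hδ : 0 < δ) (n₁ n₂ l₁ l₂ : ℤ)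
    (A : Matrix (Fin 2) (Fin 2) ℚ)
    (hA : A = !![(n₁ : ℚ), (l₁ : ℚ); (n₂ : ℚ), (l₂ : ℚ) / (δ : ℚ)])
    (hdet : A.det ≠ 0) (hgcd : Int.gcd l₂ (δ : ℤ) = 1) :
    ∃! w : ℤ × ℤ × ℤ × Matrix.SpecialLinearGroup (Fin 2) ℤ,
      0 ≤ w.2.1 ∧ w.2.1 < w.1 ∧ w.2.2.1 ≠ 0 ∧ (δ : ℤ) ∣ w.2.2.2.1 1 0 ∧
      A = !![(w.1 : ℚ), (w.2.1 : ℚ); 0, (w.2.2.1 : ℚ) / (δ : ℚ)] *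
            (w.2.2.2.1.map fun z : ℤ => (z : ℚ)) := by
  subst hA
  simp only [eq_upper_triangular_mul_iff hδ]
  have hD : n₁ * l₂ - (δ * n₂) * l₁ ≠ 0 := by
    have hδ' : (δ : ℚ) ≠ 0 := by exact_mod_cast hδ.ne'
    intro h0
    apply hdet
    have h0' : (n₁ : ℚ) * l₂ - (δ * n₂) * l₁ = 0 := by exact_mod_cast h0
    rw [Matrix.det_fin_two_of]
    field_simp
    linear_combination h0'
  obtain ⟨k, j, p, a, b, c, d, hj, hjk, hp, hP, h₁, h₂, h₃, h₄⟩ :=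
    exists_upper_triangular_mul_of_det_ne_zero n₁ l₁ (δ * n₂) l₂ hD
  have hcop : IsCoprime (δ : ℤ) p :=
    ((Int.isCoprime_iff_gcd_eq_one.mpr hgcd).of_isCoprime_of_dvd_left ⟨d, h₄.symm⟩).symm
  refine ⟨(k, j, p, ⟨!![a, b; c, d], by rw [Matrix.det_fin_two_of, hP]⟩),
    ⟨hj, hjk, hp, hcop.dvd_of_dvd_mul_left ⟨n₂, h₃⟩, h₁, h₂, h₃, h₄⟩, ?_⟩
  rintro ⟨k', j', p', P⟩ ⟨hj', hjk', hp', -, h₁', h₂', h₃', h₄'⟩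
  have hP' := P.det_coe
  rw [Matrix.det_fin_two] at hP'
  obtain ⟨rfl, rfl, rfl, ha, hb, hc, hd⟩ := upper_triangular_mul_unique hj' hjk' hp' hP' hj hjk hP
    (h₁'.trans h₁.symm) (h₂'.trans h₂.symm) (h₃'.trans h₃.symm) (h₄'.trans h₄.symm)
  congr 3
  refine Matrix.SpecialLinearGroup.ext P _ fun i i' => ?_
  fin_cases i <;> fin_cases i' <;> assumption
end

section
/- Let δ be a positive integer and let A = [[n₁, l₁],[n₂, l₂/δ]] be a nonzero 2×2 rational matrix with n₁, n₂, l₁, l₂ ∈ ℤ such that det A = 0 and no prime divisor of δ divides l₂ (i.e. gcd(l₂, δ) = 1). Then there exist integers j, p with (j,p) ≠ (0,0) and P ∈ Γ₀(δ) such that A = [[0, j],[0, p/δ]] · P; moreover this decomposition is unique up to an overall sign and a power of T: if also A = [[0, j′],[0, p′/δ]] · P′ with (j′,p′) ≠ (0,0) and P′ ∈ Γ₀(δ), then there exist ε ∈ {1, −1} and m ∈ ℤ with (j′, p′) = (ε·j, ε·p) and P′ = ε · Tᵐ · P, where T = [[1,1],[0,1]]. -/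
/-- The matrix `T = [[1,1],[0,1]]` as an element of `SL(2,ℤ)`. -/
def Tmat : Matrix.SpecialLinearGroup (Fin 2) ℤ :=
  ⟨!![1, 1; 0, 1], by norm_num [Matrix.det_fin_two_of]⟩

theorem exists_eq_mul_of_isCoprime {c d u v : ℤ} (h : IsCoprime c d) (huv : u * d = v * c) :
    ∃ k, u = k * c ∧ v = k * d := by
  obtain ⟨s, t, hst⟩ := h
  exact ⟨s * u + t * v, by linear_combination (-u) * hst + t * huv,
    by linear_combination (-v) * hst - s * huv⟩

theorem eq_of_mul_eq_of_isCoprime {c d a b : ℤ} (h : IsCoprime c d) (hc : a * c = b * c)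
    (hd : a * d = b * d) : a = b := by
  obtain ⟨s, t, hst⟩ := h
  linear_combination (b - a) * hst + s * hc + t * hd

theorem exists_primitive_of_ne_zero {x y : ℤ} (h : x ≠ 0 ∨ y ≠ 0) :
    ∃ g c d : ℤ, g ≠ 0 ∧ IsCoprime c d ∧ x = g * c ∧ y = g * d := by
  have hg : 0 < Int.gcd x y := Int.gcd_pos_iff.mpr h
  obtain ⟨c, d, hcd, hx, hy⟩ := Int.exists_gcd_one hg
  exact ⟨Int.gcd x y, c, d, by exact_mod_cast hg.ne', Int.isCoprime_iff_gcd_eq_one.mpr hcd,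
    by linarith, by linarith⟩

/-- An integral `2 × 2` matrix of rank one is the product of a column and a primitive row. -/
theorem exists_rank_one_factorization {x y u v : ℤ} (hdet : x * v = y * u)
    (h0 : ¬(x = 0 ∧ y = 0 ∧ u = 0 ∧ v = 0)) :
    ∃ j p c d : ℤ, (j, p) ≠ (0, 0) ∧ IsCoprime c d ∧
      x = j * c ∧ y = j * d ∧ u = p * c ∧ v = p * d := by
  by_cases hxy : x ≠ 0 ∨ y ≠ 0
  · obtain ⟨g, c, d, hg, hcd, rfl, rfl⟩ := exists_primitive_of_ne_zero hxy
    obtain ⟨k, hu, hv⟩ := exists_eq_mul_of_isCoprime (u := u) (v := v) hcd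
      (mul_left_cancel₀ hg (by linear_combination -hdet))
    exact ⟨g, k, c, d, by simp [hg], hcd, rfl, rfl, hu, hv⟩
  · have huv : u ≠ 0 ∨ v ≠ 0 := by tauto
    obtain ⟨g, c, d, hg, hcd, rfl, rfl⟩ := exists_primitive_of_ne_zero huv
    exact ⟨0, g, c, d, by simp [hg], hcd, by simp; tauto, by simp; tauto, rfl, rfl⟩

/-- Two primitive rows that span the same rank one integral matrix agree up to sign. -/
theorem rank_one_factorization_unique {j p c d j' p' c' d' : ℤ} (h0 : (j, p) ≠ (0, 0))
    (hcd : IsCoprime c d) (hcd' : IsCoprime c' d')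
    (hjc : j * c = j' * c') (hjd : j * d = j' * d')
    (hpc : p * c = p' * c') (hpd : p * d = p' * d') :
    ∃ ε : ℤ, (ε = 1 ∨ ε = -1) ∧ j' = ε * j ∧ p' = ε * p ∧ c' = ε * c ∧ d' = ε * d := by
  have hprop : c' * d = d' * c := by
    have hj : j * (c' * d) = j * (d' * c) := by linear_combination c' * hjd - d' * hjc
    have hp : p * (c' * d) = p * (d' * c) := by linear_combination c' * hpd - d' * hpc
    by_cases hj0 : j = 0
    · exact mul_left_cancel₀ (fun hp0 => h0 (by simp [hj0, hp0])) hp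
    · exact mul_left_cancel₀ hj0 hj
  obtain ⟨k, rfl, rfl⟩ := exists_eq_mul_of_isCoprime hcd hprop
  have hk : IsUnit k := by
    obtain ⟨s, t, hst⟩ := hcd'
    exact IsUnit.of_mul_eq_one (s * c + t * d) (by linear_combination hst)
  have hkk : k * k = 1 := Int.isUnit_mul_self hk
  have hj : j = j' * k := eq_of_mul_eq_of_isCoprime hcd (by linarith) (by linarith)
  have hp : p = p' * k := eq_of_mul_eq_of_isCoprime hcd (by linarith) (by linarith)
  exact ⟨k, Int.isUnit_iff.mp hk, by linear_combination (-j') * hkk - k * hj,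
    by linear_combination (-p') * hkk - k * hp, rfl, rfl⟩

theorem Tmat_zpow (m : ℤ) : (Tmat ^ m).1 = !![1, m; 0, 1] :=
  ModularGroup.coe_T_zpow m

theorem isCoprime_bottom_row (P : Matrix.SpecialLinearGroup (Fin 2) ℤ) :
    IsCoprime (P.1 1 0) (P.1 1 1) := by
  have h := P.2
  rw [Matrix.det_fin_two] at h
  exact ⟨-P.1 0 1, P.1 0 0, by linear_combination h⟩

/-- Matrices in `SL(2,ℤ)` whose bottom rows agree up to sign differ by that sign and a power
of `T`. -/
theorem exists_eq_smul_Tmat_zpow_mul (P P' : Matrix.SpecialLinearGroup (Fin 2) ℤ) {ε : ℤ}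
    (hε : ε = 1 ∨ ε = -1) (h0 : P'.1 1 0 = ε * P.1 1 0) (h1 : P'.1 1 1 = ε * P.1 1 1) :
    ∃ m : ℤ, P'.1 = ε • (Tmat ^ m * P).1 := by
  have hdet := P.2
  have hdet' := P'.2
  rw [Matrix.det_fin_two] at hdet hdet'
  have hεε : ε * ε = 1 := by rcases hε with rfl | rfl <;> norm_num
  obtain ⟨m, hm0, hm1⟩ := exists_eq_mul_of_isCoprime (u := ε * P'.1 0 0 - P.1 0 0)
    (v := ε * P'.1 0 1 - P.1 0 1) (isCoprime_bottom_row P) (by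
      rw [h0, h1] at hdet'
      linear_combination hdet' - hdet)
  refine ⟨m, ?_⟩
  rw [Matrix.SpecialLinearGroup.coe_mul, Tmat_zpow]
  ext i k
  fin_cases i <;> fin_cases k <;> simp [Matrix.vecMul, dotProduct, Fin.sum_univ_two]
  · linear_combination (-P'.1 0 0) * hεε + ε * hm0
  · linear_combination (-P'.1 0 1) * hεε + ε * hm1
  · exact h0
  · exact h1

/-- The factorization of the rational matrix, with the denominator cleared from its second row. -/
theorem eq_column_mul_iff {δ : ℕ} (hδ : 0 < δ) (n₁ n₂ l₁ l₂ j p : ℤ)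
    (P : Matrix (Fin 2) (Fin 2) ℤ) :
    !![(n₁ : ℚ), (l₁ : ℚ); (n₂ : ℚ), (l₂ : ℚ) / (δ : ℚ)] =
        !![0, (j : ℚ); 0, (p : ℚ) / (δ : ℚ)] * (P.map fun z : ℤ => (z : ℚ)) ↔
      n₁ = j * P 1 0 ∧ l₁ = j * P 1 1 ∧ δ * n₂ = p * P 1 0 ∧ l₂ = p * P 1 1 := by
  have hδ' : (δ : ℚ) ≠ 0 := by positivity
  have e₁ : (n₂ : ℚ) = p / δ * P 1 0 ↔ (δ : ℤ) * n₂ = p * P 1 0 := by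
    rw [div_mul_eq_mul_div, eq_div_iff hδ', mul_comm]
    norm_cast
  have e₂ : (l₂ : ℚ) / δ = p / δ * P 1 1 ↔ l₂ = p * P 1 1 := by
    rw [div_mul_eq_mul_div, div_left_inj' hδ']
    norm_cast
  rw [← e₁, ← e₂, ← Matrix.ext_iff]
  simp only [Fin.forall_fin_two, Matrix.mul_apply, Fin.sum_univ_two, Matrix.map_apply,
    Matrix.of_apply, Matrix.cons_val_zero, Matrix.cons_val_one, zero_mul, zero_add, and_assoc]
  norm_cast

/-- let `δ > 0` and `A = [[n₁,l₁],[n₂,l₂/δ]] ≠ 0` be a rational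
matrix with integer `n₁,n₂,l₁,l₂`, `det A = 0` and `gcd(l₂,δ) = 1`. Then
`A = [[0,j],[0,p/δ]] · P` for some `(j,p) ≠ (0,0)` and `P ∈ Γ₀(δ)`, and this
decomposition is unique up to an overall sign and a power of `T = [[1,1],[0,1]]`. -/
theorem stmt_13 (δ : ℕ) (hδ : 0 < δ) (n₁ n₂ l₁ l₂ : ℤ)
    (A : Matrix (Fin 2) (Fin 2) ℚ)
    (hA : A = !![(n₁ : ℚ), (l₁ : ℚ); (n₂ : ℚ), (l₂ : ℚ) / (δ : ℚ)])
    (hA0 : A ≠ 0) (hdet : A.det = 0) (hgcd : Int.gcd l₂ (δ : ℤ) = 1) :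
    (∃ (j p : ℤ) (P : Matrix.SpecialLinearGroup (Fin 2) ℤ),
        (j, p) ≠ (0, 0) ∧ (δ : ℤ) ∣ P.1 1 0 ∧
        A = !![0, (j : ℚ); 0, (p : ℚ) / (δ : ℚ)] * (P.1.map fun z : ℤ => (z : ℚ))) ∧
    (∀ (j p j' p' : ℤ) (P P' : Matrix.SpecialLinearGroup (Fin 2) ℤ),
        (j, p) ≠ (0, 0) → (δ : ℤ) ∣ P.1 1 0 →
        A = !![0, (j : ℚ); 0, (p : ℚ) / (δ : ℚ)] * (P.1.map fun z : ℤ => (z : ℚ)) →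
        (j', p') ≠ (0, 0) → (δ : ℤ) ∣ P'.1 1 0 →
        A = !![0, (j' : ℚ); 0, (p' : ℚ) / (δ : ℚ)] * (P'.1.map fun z : ℤ => (z : ℚ)) →
        ∃ (ε m : ℤ), (ε = 1 ∨ ε = -1) ∧ j' = ε * j ∧ p' = ε * p ∧
          P'.1 = ε • (Tmat ^ m * P).1) := by
  subst hA
  simp only [eq_column_mul_iff hδ]
  have hδ' : (δ : ℚ) ≠ 0 := by positivity
  constructor
  · have hd : n₁ * l₂ = l₁ * (δ * n₂) := by
      rw [Matrix.det_fin_two_of] at hdet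
      field_simp at hdet
      have h : (n₁ : ℚ) * l₂ = l₁ * (δ * n₂) := by linear_combination hdet
      exact_mod_cast h
    have hne : ¬(n₁ = 0 ∧ l₁ = 0 ∧ (δ : ℤ) * n₂ = 0 ∧ l₂ = 0) := by
      rintro ⟨rfl, rfl, hn₂, rfl⟩
      obtain rfl : n₂ = 0 := (mul_eq_zero.mp hn₂).resolve_left (by exact_mod_cast hδ.ne')
      apply hA0
      ext i k
      fin_cases i <;> fin_cases k <;> simp
    obtain ⟨j, p, c, d, hjp, hcd, h₁, h₂, h₃, h₄⟩ := exists_rank_one_factorization hd hne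
    have hδc : (δ : ℤ) ∣ c := by
      have hco : IsCoprime (δ : ℤ) p := by
        have h := Int.isCoprime_iff_gcd_eq_one.mpr hgcd
        rw [h₄] at h
        exact h.of_mul_left_left.symm
      exact hco.dvd_of_dvd_mul_left ⟨n₂, h₃.symm⟩
    obtain ⟨s, t, hst⟩ := hcd
    exact ⟨j, p, ⟨!![t, -s; c, d], by rw [Matrix.det_fin_two_of]; linear_combination hst⟩,
      hjp, by simpa using hδc, by simpa using ⟨h₁, h₂, h₃, h₄⟩⟩
  · rintro j p j' p' P P' hjp - ⟨h₁, h₂, h₃, h₄⟩ - - ⟨h₁', h₂', h₃', h₄'⟩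
    obtain ⟨ε, hε, hj, hp, hc, hd⟩ := rank_one_factorization_unique hjp
      (isCoprime_bottom_row P) (isCoprime_bottom_row P')
      (h₁.symm.trans h₁') (h₂.symm.trans h₂') (h₃.symm.trans h₃') (h₄.symm.trans h₄')
    obtain ⟨m, hm⟩ := exists_eq_smul_Tmat_zpow_mul P P' hε hc hd
    exact ⟨ε, m, hε, hj, hp, hm⟩
end

section
/- Let n and d be positive integers with d ∣ n. Then, in ℚ, Σ over squarefree divisors s of n/d of μ(s)·(1/s)·∏_{p prime, p ∣ n, p ∤ s·d} (1 + 1/p) = ∏_{p prime, p ∣ d and p ∣ (n/d)} (1 − 1/p), where μ is the Möbius function (so μ(s) = (−1)^(number of prime factors of s) for squarefree s). -/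
open Finset in
theorem moebius_prod_mul_inv_of_forall_prime {t : Finset ℕ} (ht : ∀ p ∈ t, p.Prime) :
    ((ArithmeticFunction.moebius (∏ p ∈ t, p) : ℤ) : ℚ) * (1 / ((∏ p ∈ t, p : ℕ) : ℚ)) =
      ∏ p ∈ t, (-(1 / (p : ℚ))) := by
  have hμ : ArithmeticFunction.moebius (∏ p ∈ t, p) = ∏ p ∈ t, ArithmeticFunction.moebius p :=
    ArithmeticFunction.isMultiplicative_moebius.map_prod_of_prime t ht
  rw [hμ]
  push_cast
  rw [one_div, ← prod_inv_distrib, ← prod_mul_distrib]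
  refine prod_congr rfl fun p hp => ?_
  rw [ArithmeticFunction.moebius_apply_prime (ht p hp)]
  simp

open Finset in
theorem primeFactors_mul_filter_not_dvd_prod_mul {d m : ℕ} (hd : d ≠ 0) (hm : m ≠ 0)
    {t : Finset ℕ} (ht : t ⊆ m.primeFactors) :
    (d * m).primeFactors.filter (fun p => ¬ p ∣ (∏ q ∈ t, q) * d) =
      (m.primeFactors \ t).filter (fun p => ¬ p ∣ d) := by
  ext p
  rw [Nat.primeFactors_mul hd hm]
  simp only [mem_filter, mem_union, mem_sdiff]
  by_cases hp : p.Prime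
  · have hpt : p ∣ ∏ q ∈ t, q ↔ p ∈ t := by
      refine ⟨fun h => ?_, fun h => dvd_prod_of_mem _ h⟩
      obtain ⟨q, hq, hpq⟩ := (hp.prime.dvd_finsetProd_iff _).1 h
      rwa [(Nat.prime_dvd_prime_iff_eq hp (Nat.prime_of_mem_primeFactors (ht hq))).1 hpq]
    rw [hp.dvd_mul, hpt]
    have hpd : p ∈ d.primeFactors → p ∣ d := Nat.dvd_of_mem_primeFactors
    tauto
  · simp [Nat.mem_primeFactors, hp]


/-- for positive integers `d ∣ n`, in `ℚ`:
`Σ_{s ∣ n/d, s squarefree} μ(s)·(1/s)·∏_{p prime, p∣n, p∤s·d} (1 + 1/p)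
  = ∏_{p prime, p∣d ∧ p∣(n/d)} (1 − 1/p)`. -/
theorem stmt_14 (n d : ℕ) (hn : 0 < n) (hd : 0 < d) (hdn : d ∣ n) :
    ∑ s ∈ (n / d).divisors.filter Squarefree,
        ((ArithmeticFunction.moebius s : ℤ) : ℚ) * (1 / (s : ℚ)) *
          ∏ p ∈ n.primeFactors.filter (fun p => ¬ p ∣ s * d), (1 + 1 / (p : ℚ))
      = ∏ p ∈ d.primeFactors.filter (fun p => p ∣ n / d), (1 - 1 / (p : ℚ)) := by
  obtain ⟨m, rfl⟩ := hdn
  have hm : m ≠ 0 := (Nat.pos_of_mul_pos_left hn).ne'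
  have hP : (UniqueFactorizationMonoid.normalizedFactors m).toFinset = m.primeFactors := by
    rw [Nat.factors_eq]
    rfl
  rw [Nat.mul_div_cancel_left m hd, Nat.sum_divisors_filter_squarefree hm, hP]
  calc
    _ = ∑ t ∈ m.primeFactors.powerset, (∏ p ∈ t, (-(1 / (p : ℚ)))) *
          ∏ p ∈ m.primeFactors \ t, (if ¬ p ∣ d then 1 + 1 / (p : ℚ) else 1) := by
      refine Finset.sum_congr rfl fun t ht => ?_
      have ht := Finset.mem_powerset.1 ht
      rw [Finset.prod_val, Function.id_def,
        moebius_prod_mul_inv_of_forall_prime fun p hp => Nat.prime_of_mem_primeFactors (ht hp),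
        primeFactors_mul_filter_not_dvd_prod_mul hd.ne' hm ht, Finset.prod_filter]
    _ = ∏ p ∈ m.primeFactors, (if p ∣ d then 1 - 1 / (p : ℚ) else 1) := by
      rw [← Finset.prod_add]
      refine Finset.prod_congr rfl fun p _ => ?_
      split_ifs <;> first | contradiction | ring
    _ = _ := by
      rw [← Finset.prod_filter]
      refine Finset.prod_congr ?_ fun _ _ => rfl
      ext p
      simp only [Finset.mem_filter, Nat.mem_primeFactors]
      have := hd.ne'
      tauto
end

section
/- Let Q be an invertible 6×6 rational matrix, A a 16×6 rational matrix and C a 16×16 rational matrix, and set Q* := (Q⁻¹)ᵀ and ξ := ½·AᵀCA·(1 − Q) + ½·(1 − Q*)·AᵀCA. Define the (6+6+16)×(6+6+16) block matrices 𝒬 := [[Q, 0, 0],[ξ, Q*, (1 − Q*)·AᵀC],[A·(1 − Q), 0, 1]] and Ω := [[1, 0, 0],[−½·AᵀCA, 1, −AᵀC],[A, 0, 1]]. Then Ω is invertible with Ω⁻¹ = [[1, 0, 0],[−½·AᵀCA, 1, AᵀC],[−A, 0, 1]], and Ω·𝒬·Ω⁻¹ = diag(Q, Q*, 1), the block diagonal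 matrix with blocks Q, Q*, and the 16×16 identity. -/
open Matrix

/-- The product of two block lower triangular matrices of size `m + m + n` whose lower right
`(m + n) × (m + n)` corners are block upper triangular. -/
lemma fromBlocks_fromRows_mul_fromBlocks_fromRows {m n R : Type*} [Fintype m] [Fintype n]
    [DecidableEq n] [Ring R] (a x b a' x' b' : Matrix m m R) (y y' : Matrix n m R)
    (c c' : Matrix m n R) :
    fromBlocks a 0 (fromRows x y) (fromBlocks b c 0 1) *
        fromBlocks a' 0 (fromRows x' y') (fromBlocks b' c' 0 1) =
      fromBlocks (a * a') 0 (fromRows (x * a' + b * x' + c * y') (y * a' + y'))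
        (fromBlocks (b * b') (b * c' + c) 0 1) := by
  rw [fromBlocks_multiply]
  congr 1
  · simp
  · simp
  · ext (i | i) j <;> simp [fromBlocks_mul_fromRows, add_assoc]
  · simp [fromBlocks_multiply]

/-- with `Q` an invertible 6×6 rational matrix, `A` 16×6, `C` 16×16,
`Q* := (Q⁻¹)ᵀ` and `ξ := ½·AᵀCA·(1−Q) + ½·(1−Q*)·AᵀCA`, the block matrix
`Ω = [[1,0,0],[−½AᵀCA,1,−AᵀC],[A,0,1]]` is invertible with inverse
`[[1,0,0],[−½AᵀCA,1,AᵀC],[−A,0,1]]`, and it conjugates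
`𝒬 = [[Q,0,0],[ξ,Q*,(1−Q*)AᵀC],[A(1−Q),0,1]]` into `diag(Q, Q*, 1)`. -/
theorem stmt_16 (Q : Matrix (Fin 6) (Fin 6) ℚ) (hQ : IsUnit Q)
    (A : Matrix (Fin 16) (Fin 6) ℚ) (C : Matrix (Fin 16) (Fin 16) ℚ) :
    let Qs : Matrix (Fin 6) (Fin 6) ℚ := (Q⁻¹)ᵀ
    let ξ : Matrix (Fin 6) (Fin 6) ℚ :=
      (1 / 2 : ℚ) • (Aᵀ * C * A * (1 - Q)) + (1 / 2 : ℚ) • ((1 - Qs) * (Aᵀ * C * A))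
    let 𝒬 : Matrix (Fin 6 ⊕ (Fin 6 ⊕ Fin 16)) (Fin 6 ⊕ (Fin 6 ⊕ Fin 16)) ℚ :=
      Matrix.fromBlocks Q 0 (Matrix.fromRows ξ (A * (1 - Q)))
        (Matrix.fromBlocks Qs ((1 - Qs) * (Aᵀ * C)) 0 1)
    let Ω : Matrix (Fin 6 ⊕ (Fin 6 ⊕ Fin 16)) (Fin 6 ⊕ (Fin 6 ⊕ Fin 16)) ℚ :=
      Matrix.fromBlocks 1 0 (Matrix.fromRows (-((1 / 2 : ℚ) • (Aᵀ * C * A))) A)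
        (Matrix.fromBlocks 1 (-(Aᵀ * C)) 0 1)
    let Ωinv : Matrix (Fin 6 ⊕ (Fin 6 ⊕ Fin 16)) (Fin 6 ⊕ (Fin 6 ⊕ Fin 16)) ℚ :=
      Matrix.fromBlocks 1 0 (Matrix.fromRows (-((1 / 2 : ℚ) • (Aᵀ * C * A))) (-A))
        (Matrix.fromBlocks 1 (Aᵀ * C) 0 1)
    Ω * Ωinv = 1 ∧ Ωinv * Ω = 1 ∧
      Ω * 𝒬 * Ωinv = Matrix.fromBlocks Q 0 0 (Matrix.fromBlocks Qs 0 0 1) := by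
  intro Qs ξ 𝒬 Ω Ωinv
  have rows_zero : fromRows (0 : Matrix (Fin 6) (Fin 6) ℚ) (0 : Matrix (Fin 16) (Fin 6) ℚ) = 0 := by
    simp
  refine ⟨?_, ?_, ?_⟩
  · simp only [Ω, Ωinv, fromBlocks_fromRows_mul_fromBlocks_fromRows]
    rw [← fromBlocks_one, ← fromBlocks_one, ← rows_zero]
    congr 2
    · exact mul_one 1
    · simp only [Matrix.mul_one, Matrix.one_mul, Matrix.neg_mul, Matrix.mul_neg]
      module
    · simp
    · exact mul_one 1
    · simp [Matrix.one_mul]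
  · simp only [Ω, Ωinv, fromBlocks_fromRows_mul_fromBlocks_fromRows]
    rw [← fromBlocks_one, ← fromBlocks_one, ← rows_zero]
    congr 2
    · exact mul_one 1
    · simp only [Matrix.mul_one, Matrix.one_mul, Matrix.mul_neg]
      module
    · simp
    · exact mul_one 1
    · simp [Matrix.one_mul]
  · simp only [Ω, 𝒬, Ωinv, fromBlocks_fromRows_mul_fromBlocks_fromRows]
    rw [← rows_zero]
    congr 2
    · simp
    · simp only [ξ, Matrix.mul_one, Matrix.one_mul, Matrix.neg_mul, Matrix.mul_neg,
        Matrix.mul_sub, Matrix.sub_mul, Matrix.mul_add, Matrix.add_mul, Matrix.mul_smul,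
        Matrix.smul_mul, ← Matrix.mul_assoc]
      module
    · simp [Matrix.mul_sub]
    · simp
    · simp only [Matrix.one_mul, Matrix.sub_mul]
      abel
end

section
/- Let Q be an invertible 6×6 rational matrix, A a 16×6 rational matrix and C a 16×16 rational matrix, set Q* := (Q⁻¹)ᵀ, ξ := ½·AᵀCA·(1 − Q) + ½·(1 − Q*)·AᵀCA, and let 𝒬 := [[Q, 0, 0],[ξ, Q*, (1 − Q*)·AᵀC],[A·(1 − Q), 0, 1]] be the (6+6+16)-block matrix. Then for every natural number k, 𝒬^k = [[Q^k, 0, 0],[ξ′, (Q*)^k, (1 − (Q*)^k)·AᵀC],[A·(1 − Q^k), 0, 1]], where ξ′ := ½·AᵀCA·(1 − Q^k) + ½·(1 − (Q*)^k)·AᵀCA. -/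
open Matrix

/-- The bottom-left corner of the product of two block matrices of the shape considered below:
the correction `ξ` satisfies a twisted cocycle identity. -/
theorem half_cocycle {R m n : Type*} [CommRing R] [Fintype m] [DecidableEq m] [Fintype n]
    [DecidableEq n] {c : R} (hc : c + c = 1) (M : Matrix m n R) (P P' : Matrix m m R)
    (Q Q' : Matrix n n R) :
    (c • (M * (1 - Q)) + c • ((1 - P) * M)) * Q' +
        (P * (c • (M * (1 - Q')) + c • ((1 - P') * M)) + (1 - P) * M * (1 - Q')) =
      c • (M * (1 - Q * Q')) + c • ((1 - P * P') * M) := by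
  have h : (1 - P) * M * (1 - Q') =
      c • ((1 - P) * M * (1 - Q')) + c • ((1 - P) * M * (1 - Q')) := by
    rw [← add_smul, hc, one_smul]
  rw [h]
  simp only [Matrix.add_mul, Matrix.mul_add, Matrix.smul_mul, Matrix.mul_smul, ← smul_add]
  congr 1
  simp only [Matrix.mul_sub, Matrix.sub_mul, Matrix.one_mul, Matrix.mul_one, Matrix.mul_assoc]
  abel

/-- with `Q` an invertible 6×6 rational matrix, `A` 16×6, `C` 16×16,
`Q* := (Q⁻¹)ᵀ` and `ξ := ½·AᵀCA·(1−Q) + ½·(1−Q*)·AᵀCA`, the block matrix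
`𝒬 = [[Q,0,0],[ξ,Q*,(1−Q*)AᵀC],[A(1−Q),0,1]]` satisfies, for every `k ∈ ℕ`,
`𝒬^k = [[Q^k,0,0],[ξ′,(Q*)^k,(1−(Q*)^k)AᵀC],[A(1−Q^k),0,1]]` with
`ξ′ := ½·AᵀCA·(1−Q^k) + ½·(1−(Q*)^k)·AᵀCA`. -/
theorem stmt_17 (Q : Matrix (Fin 6) (Fin 6) ℚ) (hQ : IsUnit Q)
    (A : Matrix (Fin 16) (Fin 6) ℚ) (C : Matrix (Fin 16) (Fin 16) ℚ) :
    let Qs : Matrix (Fin 6) (Fin 6) ℚ := (Q⁻¹)ᵀ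
    let ξ : Matrix (Fin 6) (Fin 6) ℚ :=
      (1 / 2 : ℚ) • (Aᵀ * C * A * (1 - Q)) + (1 / 2 : ℚ) • ((1 - Qs) * (Aᵀ * C * A))
    let 𝒬 : Matrix (Fin 6 ⊕ (Fin 6 ⊕ Fin 16)) (Fin 6 ⊕ (Fin 6 ⊕ Fin 16)) ℚ :=
      Matrix.fromBlocks Q 0 (Matrix.fromRows ξ (A * (1 - Q)))
        (Matrix.fromBlocks Qs ((1 - Qs) * (Aᵀ * C)) 0 1)
    ∀ k : ℕ,
      𝒬 ^ k =
        Matrix.fromBlocks (Q ^ k) 0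
          (Matrix.fromRows
            ((1 / 2 : ℚ) • (Aᵀ * C * A * (1 - Q ^ k)) +
              (1 / 2 : ℚ) • ((1 - Qs ^ k) * (Aᵀ * C * A)))
            (A * (1 - Q ^ k)))
          (Matrix.fromBlocks (Qs ^ k) ((1 - Qs ^ k) * (Aᵀ * C)) 0 1) := by
  intro Qs ξ 𝒬 k
  induction k with
  | zero => simp
  | succ k ih =>
    have hξ := half_cocycle (by norm_num : (1 / 2 : ℚ) + 1 / 2 = 1) (Aᵀ * C * A) (Qs ^ k) Qs
      (Q ^ k) Q
    rw [pow_succ, ih]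
    simp only [𝒬, ξ, Matrix.fromBlocks_multiply, Matrix.fromRows_mul,
      Matrix.fromBlocks_mul_fromRows, Matrix.zero_mul, Matrix.mul_zero, Matrix.one_mul,
      Matrix.mul_one, add_zero, zero_add, pow_succ]
    rw [← hξ]
    congr 1
    · ext (i | i) j
      · simp [Matrix.mul_assoc]
      · simp [Matrix.mul_sub, Matrix.sub_mul, Matrix.mul_assoc]
    · congr 1
      simp only [Matrix.mul_sub, Matrix.sub_mul, Matrix.one_mul, Matrix.mul_assoc]
      abel
end
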